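/- arXiv:2504.15186 — 5 statements merged into one kernel-verified Lean document; each statement's English description precedes it below -/
import Mathlib

section
/- Let n ≥ 1 and let θ_1, …, θ_n > 0 be pairwise distinct. Then the coefficients R_{ik} sum to one: ∑_{i=1}^{n} ∑_{k=1}^{3} R_{ik} = 1. -/
open MeasureTheory ProbabilityTheory Finset Filter Topology

/-- The XGamma probability density function with scale parameter `θ`. -/
noncomputable def xgPDF (θ t : ℝ) : ℝ :=
  if 0 ≤ t then θ ^ 2 / (1 + θ) * (1 + θ / 2 * t ^ 2) * Real.exp (-θ * t) else 0

/-- The Erlang probability density function with shape `m` and rate `θ`. -/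
noncomputable def erlangPDF (m : ℕ) (θ t : ℝ) : ℝ :=
  if 0 ≤ t then (θ * t) ^ (m - 1) * θ * Real.exp (-θ * t) / (m - 1).factorial else 0

/-- The coefficient `A_{i1}`. -/
noncomputable def Acoef1 {n : ℕ} (θ : Fin n → ℝ) (i : Fin n) : ℝ :=
  θ i * ∏ j ∈ Finset.univ.erase i, ((θ j - θ i) ^ 2 + θ j) / (θ j - θ i) ^ 3

/-- The coefficient `A_{i2}`. -/
noncomputable def Acoef2 {n : ℕ} (θ : Fin n → ℝ) (i : Fin n) : ℝ :=
  Acoef1 θ i * ∑ j ∈ Finset.univ.erase i,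
    (2 * (θ j - θ i) / ((θ j - θ i) ^ 2 + θ j) - 3 / (θ j - θ i))

/-- The coefficient `A_{i3}`. -/
noncomputable def Acoef3 {n : ℕ} (θ : Fin n → ℝ) (i : Fin n) : ℝ :=
  Acoef1 θ i / 2 * (∑ j ∈ Finset.univ.erase i,
    (2 * (θ j - θ i) / ((θ j - θ i) ^ 2 + θ j) - 3 / (θ j - θ i))) ^ 2
  + Acoef1 θ i / 2 * (2 / θ i + ∑ j ∈ Finset.univ.erase i,
    (-2 * ((θ j - θ i) ^ 2 - θ j) / ((θ j - θ i) ^ 2 + θ j) ^ 2 + 3 / (θ j - θ i) ^ 2))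

/-- The coefficients `A_{ik}`, `k = 1, 2, 3`. -/
noncomputable def Acoef {n : ℕ} (θ : Fin n → ℝ) (i : Fin n) : ℕ → ℝ
  | 1 => Acoef1 θ i
  | 2 => Acoef2 θ i
  | 3 => Acoef3 θ i
  | _ => 0

/-- The coefficients `R_{ik} = (∏ l θ_l²/(1+θ_l)) · A_{ik}/θ_i^{4-k}`. -/
noncomputable def Rcoef {n : ℕ} (θ : Fin n → ℝ) (i : Fin n) (k : ℕ) : ℝ :=
  (∏ l, θ l ^ 2 / (1 + θ l)) * Acoef θ i k / θ i ^ (4 - k)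

open Polynomial in
lemma xg_step (U : ℝ[X]) (c t : ℝ) (hc : c ≠ 0) (ht : 0 < t) :
    U ^ 3 ∣ ((U + C c) ^ 2 + C t) - C ((c ^ 2 + t) / c ^ 3) *
      (1 + C (2 * c / (c ^ 2 + t) - 3 / c) * U +
        C (((2 * c / (c ^ 2 + t) - 3 / c) ^ 2
          + (-2 * (c ^ 2 - t) / (c ^ 2 + t) ^ 2 + 3 / c ^ 2)) / 2) * U ^ 2) * (U + C c) ^ 3 := by
  have hq : c ^ 2 + t ≠ 0 := by positivity
  obtain ⟨p, hp⟩ : ∃ p, p = (c ^ 2 + t) / c ^ 3 := ⟨_, rfl⟩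
  obtain ⟨a, ha⟩ : ∃ a, a = 2 * c / (c ^ 2 + t) - 3 / c := ⟨_, rfl⟩
  obtain ⟨e, he⟩ : ∃ e, e = (a ^ 2
          + (-2 * (c ^ 2 - t) / (c ^ 2 + t) ^ 2 + 3 / c ^ 2)) / 2 := ⟨_, rfl⟩
  have h0 : p * c ^ 3 = c ^ 2 + t := by rw [hp]; field_simp
  have h1 : p * (3 * c ^ 2 + a * c ^ 3) = 2 * c := by
    rw [hp, ha]; field_simp; ring
  have h2 : p * (3 * c + 3 * c ^ 2 * a + c ^ 3 * e) = 1 := by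
    rw [he, hp, ha]; field_simp; ring
  rw [← hp, ← ha, ← he]
  have h0' := congrArg (C : ℝ →+* ℝ[X]) h0
  have h1' := congrArg (C : ℝ →+* ℝ[X]) h1
  have h2' := congrArg (C : ℝ →+* ℝ[X]) h2
  simp only [map_mul, map_add, map_pow, map_ofNat, map_one] at h0' h1' h2'
  refine ⟨-(C p * (1 + 3 * C c * C a + 3 * C c ^ 2 * C e + (C a + 3 * C c * C e) * U
    + C e * U ^ 2)), ?_⟩
  linear_combination -h0' - U * h1' - U ^ 2 * h2'

open Polynomial in
lemma xg_prod {ι : Type*} [DecidableEq ι] (U : ℝ[X]) (s : Finset ι) (c t : ι → ℝ)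
    (hc : ∀ j ∈ s, c j ≠ 0) (ht : ∀ j ∈ s, 0 < t j) :
    U ^ 3 ∣ (∏ j ∈ s, ((U + C (c j)) ^ 2 + C (t j))) -
      C (∏ j ∈ s, ((c j ^ 2 + t j) / c j ^ 3)) *
      (1 + C (∑ j ∈ s, (2 * c j / (c j ^ 2 + t j) - 3 / c j)) * U +
        C (((∑ j ∈ s, (2 * c j / (c j ^ 2 + t j) - 3 / c j)) ^ 2
          + ∑ j ∈ s, (-2 * (c j ^ 2 - t j) / (c j ^ 2 + t j) ^ 2 + 3 / c j ^ 2)) / 2) * U ^ 2) *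
        ∏ j ∈ s, (U + C (c j)) ^ 3 := by
  induction s using Finset.induction_on with
  | empty => simp
  | insert k s hk ih =>
    obtain ⟨w, hw⟩ := ih (fun j hj => hc j (Finset.mem_insert_of_mem hj))
      (fun j hj => ht j (Finset.mem_insert_of_mem hj))
    obtain ⟨v, hv⟩ := xg_step U (c k) (t k) (hc k (Finset.mem_insert_self _ _))
      (ht k (Finset.mem_insert_self _ _))
    simp only [Finset.prod_insert hk, Finset.sum_insert hk]
    generalize (∑ j ∈ s, (2 * c j / (c j ^ 2 + t j) - 3 / c j)) = S at *
    generalize (∑ j ∈ s, (-2 * (c j ^ 2 - t j) / (c j ^ 2 + t j) ^ 2 + 3 / c j ^ 2)) = T at *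
    generalize (∏ j ∈ s, ((c j ^ 2 + t j) / c j ^ 3)) = P at *
    generalize (∏ j ∈ s, ((U + C (c j)) ^ 2 + C (t j))) = N at *
    generalize (∏ j ∈ s, (U + C (c j)) ^ 3) = D at *
    generalize (2 * c k / (c k ^ 2 + t k) - 3 / c k) = a at *
    generalize (-2 * (c k ^ 2 - t k) / (c k ^ 2 + t k) ^ 2 + 3 / c k ^ 2) = b at *
    generalize ((c k ^ 2 + t k) / c k ^ 3) = p at *
    generalize ((U + C (c k)) ^ 2 + C (t k)) = N' at *
    generalize (U + C (c k)) ^ 3 = D' at *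
    obtain ⟨e, he⟩ : ∃ e, e = (a ^ 2 + b) / 2 := ⟨_, rfl⟩
    obtain ⟨f, hf⟩ : ∃ f, f = (S ^ 2 + T) / 2 := ⟨_, rfl⟩
    have hef : ((a + S) ^ 2 + (b + T)) / 2 = e + f + a * S := by rw [he, hf]; ring
    rw [hef]
    rw [← he] at hv
    rw [← hf] at hw
    simp only [map_mul, map_add]
    refine ⟨v * N + C p * (1 + C a * U + C e * U ^ 2) * D' * w
      + C p * C P * D' * D * (C a * C f + C e * C S + C e * C f * U), ?_⟩
    linear_combination N * hv + C p * (1 + C a * U + C e * U ^ 2) * D' * hw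

open Polynomial in
lemma xg_key {n : ℕ} (hn : 1 ≤ n)
    (θ : Fin n → ℝ) (hθpos : ∀ i, 0 < θ i) (hθdist : Function.Injective θ) :
    (∏ j, ((X + C (θ j)) ^ 2 + C (θ j)) : ℝ[X]) -
      ∑ i, (C (Acoef1 θ i) + C (Acoef2 θ i) * (X + C (θ i)) + C (Acoef3 θ i) * (X + C (θ i)) ^ 2)
        * ∏ j ∈ Finset.univ.erase i, (X + C (θ j)) ^ 3 = 0 := by
  have hlin : ∀ a : ℝ, (X + C a).natDegree = 1 := fun a => natDegree_X_add_C a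
  have hDm : (∏ j, (X + C (θ j)) ^ 3 : ℝ[X]).Monic :=
    monic_prod_of_monic _ _ fun j _ => (monic_X_add_C _).pow 3
  have hDd : (∏ j, (X + C (θ j)) ^ 3 : ℝ[X]).natDegree = 3 * n := by
    rw [natDegree_prod_of_monic _ _ fun j _ => (monic_X_add_C _).pow 3]
    simp [natDegree_pow, mul_comm]
  apply eq_zero_of_dvd_of_degree_lt (p := (∏ j, (X + C (θ j)) ^ 3 : ℝ[X]))
  · apply Finset.prod_dvd_of_coprime
    · intro i _ j _ hij
      apply IsCoprime.pow
      have := pairwise_coprime_X_sub_C (K := ℝ) (s := fun i => - θ i)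
        (fun a b h => hθdist (neg_injective h)) hij
      simpa [Function.onFun] using this
    · intro i _
      set U : ℝ[X] := X + C (θ i) with hU
      have hUj : ∀ j, X + C (θ j) = U + C (θ j - θ i) := by
        intro j; rw [hU, map_sub]; ring
      have h := xg_prod U (Finset.univ.erase i) (fun j => θ j - θ i) θ
        (fun j hj => by
          have : j ≠ i := (Finset.mem_erase.mp hj).1
          exact sub_ne_zero.mpr fun h => this (hθdist h))
        (fun j _ => hθpos j)
      rw [← Finset.add_sum_erase _ _ (Finset.mem_univ i),
        ← Finset.mul_prod_erase _ _ (Finset.mem_univ i), ← sub_sub]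
      apply dvd_sub
      · simp only [hUj]
        simp only [sub_self, map_zero, add_zero]
        obtain ⟨w, hw⟩ := h
        unfold Acoef2 Acoef3 Acoef1
        have hi := (hθpos i).ne'
        generalize (∑ j ∈ Finset.univ.erase i, (2 * (θ j - θ i) / ((θ j - θ i) ^ 2 + θ j) - 3 / (θ j - θ i))) = S at *
        generalize (∑ j ∈ Finset.univ.erase i, (-2 * ((θ j - θ i) ^ 2 - θ j) / ((θ j - θ i) ^ 2 + θ j) ^ 2 + 3 / (θ j - θ i) ^ 2)) = T at *
        generalize (∏ j ∈ Finset.univ.erase i, (((θ j - θ i) ^ 2 + θ j) / (θ j - θ i) ^ 3)) = P at *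
        obtain ⟨f, hf⟩ : ∃ f, f = (S ^ 2 + T) / 2 := ⟨_, rfl⟩
        have h3 : θ i * P / 2 * S ^ 2 + θ i * P / 2 * (2 / θ i + T) = P + θ i * P * f := by
          rw [hf]; field_simp
          try ring
        rw [h3]
        rw [← hf] at hw
        simp only [map_mul, map_add]
        refine ⟨(U ^ 2 + C (θ i)) * w + C P * (C S + C f * U) *
          ∏ j ∈ Finset.univ.erase i, (U + C (θ j - θ i)) ^ 3, ?_⟩
        linear_combination (U ^ 2 + C (θ i)) * hw
      · apply Finset.dvd_sum
        intro k hk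
        apply Dvd.dvd.mul_left
        apply Finset.dvd_prod_of_mem (fun j => (X + C (θ j)) ^ 3 : Fin n → ℝ[X])
        simp [(Finset.mem_erase.mp hk).1.symm]
  · rw [degree_eq_natDegree hDm.ne_zero, hDd, ← mem_degreeLT]
    apply Submodule.sub_mem
    · rw [mem_degreeLT]
      refine lt_of_le_of_lt degree_le_natDegree ?_
      have h1 : (∏ j, ((X + C (θ j)) ^ 2 + C (θ j)) : ℝ[X]).natDegree ≤ ∑ j : Fin n, 2 := by
        refine (natDegree_prod_le _ _).trans (Finset.sum_le_sum fun j _ => ?_)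
        compute_degree
      simp at h1
      have : (∏ j, ((X + C (θ j)) ^ 2 + C (θ j)) : ℝ[X]).natDegree < 3 * n := by omega
      exact_mod_cast this
    · apply Submodule.sum_mem
      intro i _
      rw [mem_degreeLT]
      refine lt_of_le_of_lt degree_le_natDegree ?_
      have h2 : (∏ j ∈ Finset.univ.erase i, (X + C (θ j)) ^ 3 : ℝ[X]).natDegree ≤ ∑ j ∈ Finset.univ.erase i, 3 := by
        refine (natDegree_prod_le _ _).trans (Finset.sum_le_sum fun j _ => ?_)
        compute_degree
      have h1 : (C (Acoef1 θ i) + C (Acoef2 θ i) * (X + C (θ i)) + C (Acoef3 θ i) * (X + C (θ i)) ^ 2).natDegree ≤ 2 := by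
        compute_degree
      simp [Finset.card_erase_of_mem] at h2
      have := (natDegree_mul_le (p := (C (Acoef1 θ i) + C (Acoef2 θ i) * (X + C (θ i)) + C (Acoef3 θ i) * (X + C (θ i)) ^ 2)) (q := ∏ j ∈ Finset.univ.erase i, (X + C (θ j)) ^ 3)).trans (add_le_add h1 h2)
      have h4 := lt_of_le_of_lt this (show 2 + (n - 1) * 3 < 3 * n by omega)
      exact_mod_cast h4

/-- The coefficients `R_{ik}` of the HypoXGamma distribution sum to one. -/
theorem sum_Rcoef_eq_one {n : ℕ} (hn : 1 ≤ n)
    (θ : Fin n → ℝ) (hθpos : ∀ i, 0 < θ i) (hθdist : Function.Injective θ) :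
    ∑ i, ∑ k ∈ Finset.Icc 1 3, Rcoef θ i k = 1 := by
  have h := congrArg (Polynomial.eval 0) (xg_key hn θ hθpos hθdist)
  simp only [Polynomial.eval_sub, Polynomial.eval_prod, Polynomial.eval_finset_sum,
    Polynomial.eval_add, Polynomial.eval_mul, Polynomial.eval_pow, Polynomial.eval_X,
    Polynomial.eval_C, Polynomial.eval_zero, zero_add] at h
  have hD : (∏ j, θ j ^ 3) ≠ 0 := Finset.prod_ne_zero_iff.mpr fun j _ => (pow_pos (hθpos j) 3).ne'
  have hR : ∀ i, ∑ k ∈ Finset.Icc 1 3, Rcoef θ i k = (∏ l, θ l ^ 2 / (1 + θ l)) / (∏ j, θ j ^ 3) *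
      ((Acoef1 θ i + Acoef2 θ i * θ i + Acoef3 θ i * θ i ^ 2)
        * ∏ j ∈ Finset.univ.erase i, θ j ^ 3) := by
    intro i
    have hi := (hθpos i).ne'
    have hE : (∏ j ∈ Finset.univ.erase i, θ j ^ 3) ≠ 0 :=
      Finset.prod_ne_zero_iff.mpr fun j _ => (pow_pos (hθpos j) 3).ne'
    rw [← Finset.mul_prod_erase _ (fun j => θ j ^ 3) (Finset.mem_univ i)]
    have : Finset.Icc 1 3 = ({1, 2, 3} : Finset ℕ) := by decide
    rw [this]
    simp [Rcoef, Acoef]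
    generalize (∏ j ∈ Finset.univ.erase i, θ j ^ 3) = E at *
    generalize (∏ l, θ l ^ 2) = A at *
    generalize (∏ l, (1 + θ l)) = B at *
    field_simp
    try ring
  rw [Finset.sum_congr rfl fun i _ => hR i, ← Finset.mul_sum, ← sub_eq_zero.mp h,
    ← Finset.prod_div_distrib, ← Finset.prod_mul_distrib]
  apply Finset.prod_eq_one
  intro j _
  have := hθpos j
  field_simp
  try ring
end

section
/- Let n ≥ 1 and let θ_1, …, θ_n > 0 be pairwise distinct. Then for every real t with t ≠ −θ_i for all i, the partial fraction (Heaviside) decomposition holds: ∏_{i=1}^{n} ((θ_i + t)² + θ_i)/(θ_i + t)³ = ∑_{i=1}^{n} ∑_{k=1}^{3} A_{ik}/(θ_i + t)^{4−k}. -/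
open MeasureTheory ProbabilityTheory Finset Filter Topology

theorem hv_single {R : Type*} [CommRing R] (x d th g s q : R)
    (h0 : d ^ 2 + th = g * d ^ 3) (h1 : 2 * d = g * (3 * d ^ 2 + s * d ^ 3))
    (h2 : 1 = g * (3 * d + 3 * d ^ 2 * s + d ^ 3 * q)) :
    x ^ 3 ∣ ((d + x) ^ 2 + th) - g * (1 + s * x + q * x ^ 2) * (d + x) ^ 3 := by
  refine ⟨-g * ((1 + 3 * d * s + 3 * d ^ 2 * q) + (s + 3 * d * q) * x + q * x ^ 2), ?_⟩
  linear_combination h0 + x * h1 + x ^ 2 * h2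

theorem hv_mul {R : Type*} [CommRing R] (x u v u' v' w g s q g' s' q' : R)
    (hu : x ^ 3 ∣ u - g * (1 + s * x + q * x ^ 2) * v)
    (hu' : x ^ 3 ∣ u' - g' * (1 + s' * x + q' * x ^ 2) * v')
    (hw : w = q + q' + s * s') :
    x ^ 3 ∣ u * u' - (g * g') * (1 + (s + s') * x + w * x ^ 2) * (v * v') := by
  obtain ⟨a, ha⟩ := hu
  obtain ⟨b, hb⟩ := hu'
  subst hw
  refine ⟨a * u' + g * (1 + s * x + q * x ^ 2) * v * b
    + g * g' * v * v' * (s * q' + q * s' + q * q' * x), ?_⟩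
  linear_combination u' * ha + g * (1 + s * x + q * x ^ 2) * v * hb

open Polynomial in
theorem hv_prod {ι : Type*} [DecidableEq ι] (θ : ι → ℝ) (hpos : ∀ i, 0 < θ i) (c : ℝ)
    (S : Finset ι) (hS : ∀ j ∈ S, θ j ≠ c) :
    (X + C c) ^ 3 ∣ (∏ j ∈ S, ((X + C (θ j)) ^ 2 + C (θ j)))
      - C (∏ j ∈ S, ((θ j - c) ^ 2 + θ j) / (θ j - c) ^ 3)
        * (1 + C (∑ j ∈ S, (2 * (θ j - c) / ((θ j - c) ^ 2 + θ j) - 3 / (θ j - c))) * (X + C c)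
          + C (((∑ j ∈ S, (2 * (θ j - c) / ((θ j - c) ^ 2 + θ j) - 3 / (θ j - c))) ^ 2
            + ∑ j ∈ S, (-2 * ((θ j - c) ^ 2 - θ j) / ((θ j - c) ^ 2 + θ j) ^ 2
              + 3 / (θ j - c) ^ 2)) / 2) * (X + C c) ^ 2)
        * ∏ j ∈ S, (X + C (θ j)) ^ 3 := by
  induction S using Finset.induction_on with
  | empty => simp
  | insert j S hj ih =>
    have ih' := ih (fun k hk => hS k (Finset.mem_insert_of_mem hk))
    have hd : θ j - c ≠ 0 := sub_ne_zero.mpr (hS j (Finset.mem_insert_self _ _))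
    have hp : (θ j - c) ^ 2 + θ j ≠ 0 := by have := hpos j; positivity
    rw [Finset.prod_insert hj, Finset.prod_insert hj, Finset.prod_insert hj,
      Finset.sum_insert hj, Finset.sum_insert hj, C_mul, C_add]
    have hX : (X + C (θ j) : ℝ[X]) = C (θ j - c) + (X + C c) := by
      rw [C_sub]; ring
    refine hv_mul (X + C c) _ _ _ _ _ _ _ (C (((2 * (θ j - c) / ((θ j - c) ^ 2 + θ j)
      - 3 / (θ j - c)) ^ 2 + (-2 * ((θ j - c) ^ 2 - θ j) / ((θ j - c) ^ 2 + θ j) ^ 2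
              + 3 / (θ j - c) ^ 2)) / 2)) _ _ _ ?_ ih' ?_
    · rw [hX]
      generalize θ j - c = d at *
      generalize θ j = e at *
      apply hv_single
      · simp only [← C_mul, ← C_pow, ← C_add]
        congr 1
        field_simp
      · have : (2 : ℝ[X]) = C 2 := rfl
        have h3 : (3 : ℝ[X]) = C 3 := rfl
        simp only [this, h3, ← C_mul, ← C_pow, ← C_add]
        congr 1
        field_simp
        ring
      · have : (1 : ℝ[X]) = C 1 := rfl
        have h3 : (3 : ℝ[X]) = C 3 := rfl
        simp only [this, h3, ← C_mul, ← C_pow, ← C_add]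
        congr 1
        field_simp
        ring
    · simp only [← C_mul, ← C_add]
      congr 1
      ring

open Polynomial in
theorem hv_poly {n : ℕ} (hn : 1 ≤ n)
    (θ : Fin n → ℝ) (hθpos : ∀ i, 0 < θ i) (hθdist : Function.Injective θ) :
    (∏ i, ((X + C (θ i)) ^ 2 + C (θ i)) : ℝ[X])
      = ∑ i, (C (Acoef1 θ i) + C (Acoef2 θ i) * (X + C (θ i)) + C (Acoef3 θ i) * (X + C (θ i)) ^ 2)
        * ∏ j ∈ Finset.univ.erase i, (X + C (θ j)) ^ 3 := by
  rw [← sub_eq_zero]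
  have hmon : ∀ s : Finset (Fin n), (∏ i ∈ s, (X + C (θ i)) ^ 3 : ℝ[X]).Monic := fun s =>
    monic_prod_of_monic _ _ (fun i _ => (monic_X_add_C _).pow 3)
  have hdeg : ∀ s : Finset (Fin n), (∏ i ∈ s, (X + C (θ i)) ^ 3 : ℝ[X]).natDegree = 3 * s.card := by
    intro s
    rw [natDegree_prod_of_monic _ _ (fun i _ => (monic_X_add_C _).pow 3)]
    simp [mul_comm]
  apply Polynomial.eq_zero_of_dvd_of_natDegree_lt (p := ∏ i, (X + C (θ i)) ^ 3)
  · apply Finset.prod_dvd_of_coprime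
    · intro i _ j _ hij
      apply IsCoprime.pow
      have hne : θ i - θ j ≠ 0 := sub_ne_zero.mpr (fun h => hij (hθdist h))
      refine ⟨C (1 / (θ i - θ j)), -C (1 / (θ i - θ j)), ?_⟩
      have : C (1 / (θ i - θ j)) * (C (θ i) - C (θ j)) = (1 : ℝ[X]) := by
        rw [← C_sub, ← C_mul, one_div_mul_cancel hne, C_1]
      linear_combination this
    · intro i _
      rw [← Finset.add_sum_erase _ _ (Finset.mem_univ i), ← sub_sub]
      apply dvd_sub
      · rw [← Finset.mul_prod_erase _ _ (Finset.mem_univ i)]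
        obtain ⟨a, ha⟩ := hv_prod θ hθpos (θ i) (Finset.univ.erase i)
          (fun j hj h => Finset.ne_of_mem_erase hj (hθdist h))
        have hi := (hθpos i).ne'
        unfold Acoef3 Acoef2 Acoef1
        generalize (∏ j ∈ Finset.univ.erase i, ((X + C (θ j)) ^ 2 + C (θ j))) = U at *
        generalize (∏ j ∈ Finset.univ.erase i, (X + C (θ j)) ^ 3) = V at *
        generalize (∏ j ∈ Finset.univ.erase i, ((θ j - θ i) ^ 2 + θ j) / (θ j - θ i) ^ 3) = g at *
        generalize (∑ j ∈ Finset.univ.erase i,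
          (2 * (θ j - θ i) / ((θ j - θ i) ^ 2 + θ j) - 3 / (θ j - θ i))) = s at *
        generalize (∑ j ∈ Finset.univ.erase i, (-2 * ((θ j - θ i) ^ 2 - θ j) /
          ((θ j - θ i) ^ 2 + θ j) ^ 2 + 3 / (θ j - θ i) ^ 2)) = r at *
        have e3 : θ i * g / 2 * s ^ 2 + θ i * g / 2 * (2 / θ i + r)
            = g + θ i * g * ((s ^ 2 + r) / 2) := by
          field_simp
          ring
        rw [e3]
        generalize (s ^ 2 + r) / 2 = q at *
        generalize θ i = e at *
        simp only [C_mul, C_add]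
        refine ⟨((X + C e) ^ 2 + C e) * a + C g * V * (C s + C q * (X + C e)), ?_⟩
        linear_combination ((X + C e) ^ 2 + C e) * ha
      · apply Finset.dvd_sum
        intro j hj
        apply Dvd.dvd.mul_left
        exact Finset.dvd_prod_of_mem (fun j => (X + C (θ j)) ^ 3)
          (Finset.mem_erase.mpr ⟨(Finset.ne_of_mem_erase hj).symm, Finset.mem_univ i⟩)
  · rw [hdeg]
    simp only [Finset.card_univ, Fintype.card_fin]
    have key : ∀ p : ℝ[X], p.natDegree ≤ 3 * n - 1 → p.natDegree < 3 * n := by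
      intro p hp; omega
    apply key
    refine (natDegree_sub_le _ _).trans (max_le ?_ ?_)
    · refine (natDegree_prod_le _ _).trans ?_
      refine (Finset.sum_le_card_nsmul _ _ 2 ?_).trans ?_
      · intro i _
        compute_degree
      · simp; omega
    · apply natDegree_sum_le_of_forall_le
      intro i _
      refine natDegree_mul_le.trans ?_
      rw [hdeg, Finset.card_erase_of_mem (Finset.mem_univ i)]
      have : (C (Acoef1 θ i) + C (Acoef2 θ i) * (X + C (θ i))
        + C (Acoef3 θ i) * (X + C (θ i)) ^ 2).natDegree ≤ 2 := by compute_degree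
      simp only [Finset.card_univ, Fintype.card_fin]
      omega

/-- The Heaviside partial fraction decomposition
`∏ i ((θ_i+t)²+θ_i)/(θ_i+t)³ = ∑ i ∑ k A_{ik}/(θ_i+t)^{4-k}`. -/
theorem heaviside_decomposition {n : ℕ} (hn : 1 ≤ n)
    (θ : Fin n → ℝ) (hθpos : ∀ i, 0 < θ i) (hθdist : Function.Injective θ) :
    ∀ t : ℝ, (∀ i, t ≠ -θ i) →
      ∏ i, ((θ i + t) ^ 2 + θ i) / (θ i + t) ^ 3
        = ∑ i, ∑ k ∈ Finset.Icc 1 3, Acoef θ i k / (θ i + t) ^ (4 - k) := by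
  intro t ht
  have hne : ∀ i, θ i + t ≠ 0 := fun i h => ht i (by linarith)
  have h := congrArg (Polynomial.eval t) (hv_poly hn θ hθpos hθdist)
  simp only [Polynomial.eval_prod, Polynomial.eval_finsetSum, Polynomial.eval_add,
    Polynomial.eval_mul, Polynomial.eval_pow, Polynomial.eval_X, Polynomial.eval_C,
    add_comm t] at h
  rw [Finset.prod_div_distrib, h, Finset.sum_div]
  refine Finset.sum_congr rfl (fun i _ => ?_)
  rw [← Finset.mul_prod_erase _ (fun j => (θ j + t) ^ 3) (Finset.mem_univ i)]
  have hV : ∏ j ∈ Finset.univ.erase i, (θ j + t) ^ 3 ≠ 0 :=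
    Finset.prod_ne_zero_iff.mpr (fun j _ => pow_ne_zero _ (hne j))
  have hI : Finset.Icc 1 3 = ({1, 2, 3} : Finset ℕ) := by decide
  rw [mul_div_mul_right _ _ hV, hI]
  have := hne i
  simp [Acoef]
  field_simp
  ring
end

section
/- Let n ≥ 1 and let θ_1, …, θ_n > 0 be pairwise distinct. For each i, let g(s) = (s + θ_i)³ · ∏_{j=1}^{n} ((θ_j + s)² + θ_j)/(θ_j + s)³, defined for s in a punctured neighborhood of −θ_i and extended by its limit at −θ_i. Then lim_{s → −θ_i} g′(s) = A_{i1} · ∑_{j≠i} ( 2(θ_j − θ_i)/((θ_j − θ_i)² + θ_j) − 3/(θ_j − θ_i) ), i.e. the limit of the first derivative equals A_{i2}. -/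
open MeasureTheory ProbabilityTheory Finset Filter Topology

/-- `g(s) = (s+θ_i)³ ∏ j ((θ_j+s)²+θ_j)/(θ_j+s)³`, extended by its limit `A_{i1}`
at `s = -θ_i`. -/
noncomputable def gfun {n : ℕ} (θ : Fin n → ℝ) (i : Fin n) (s : ℝ) : ℝ :=
  if s = -θ i then Acoef1 θ i
  else (s + θ i) ^ 3 * ∏ j, ((θ j + s) ^ 2 + θ j) / (θ j + s) ^ 3

/-- The limit of the first derivative of `g` at `s = -θ_i` equals `A_{i2}`. -/
theorem limit_deriv_Acoef2 {n : ℕ} (hn : 1 ≤ n)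
    (θ : Fin n → ℝ) (hθpos : ∀ i, 0 < θ i) (hθdist : Function.Injective θ) (i : Fin n) :
    Tendsto (deriv (gfun θ i)) (𝓝[≠] (-θ i)) (𝓝 (Acoef2 θ i)) := by
  have hne : ∀ j ∈ Finset.univ.erase i, θ j + -θ i ≠ 0 := by
    intro j hj h
    exact (Finset.mem_erase.1 hj).1 (hθdist (by linarith))
  set h : ℝ → ℝ := fun s => ((θ i + s) ^ 2 + θ i) *
    ∏ j ∈ Finset.univ.erase i, ((θ j + s) ^ 2 + θ j) / (θ j + s) ^ 3 with hh
  have hg : gfun θ i = h := by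
    funext s
    by_cases hs : s = -θ i
    · subst hs
      simp [gfun, hh, Acoef1, sub_eq_add_neg]
    · have h0 : θ i + s ≠ 0 := fun h' => hs (by linarith)
      simp only [gfun, hs, if_false, hh]
      rw [← Finset.mul_prod_erase Finset.univ _ (Finset.mem_univ i), ← mul_assoc, add_comm s]
      congr 1
      field_simp
  have han : AnalyticAt ℝ h (-θ i) := by
    refine AnalyticAt.mul (by fun_prop) ?_
    refine Finset.analyticAt_fun_prod _ fun j hj => ?_
    exact AnalyticAt.div (by fun_prop) (by fun_prop) (pow_ne_zero 3 (hne j hj))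
  have hder : HasDerivAt h (Acoef2 θ i) (-θ i) := by
    have hf : ∀ j ∈ Finset.univ.erase i,
        HasDerivAt (fun s : ℝ => ((θ j + s) ^ 2 + θ j) / (θ j + s) ^ 3)
          (((θ j + -θ i) ^ 2 + θ j) / (θ j + -θ i) ^ 3 *
            (2 * (θ j - θ i) / ((θ j - θ i) ^ 2 + θ j) - 3 / (θ j - θ i))) (-θ i) := by
      intro j hj
      have h1 := hne j hj
      have h2 : (θ j + -θ i) ^ 2 + θ j ≠ 0 := by have := hθpos j; positivity
      have hid : HasDerivAt (fun s : ℝ => θ j + s) 1 (-θ i) := (hasDerivAt_id' _).const_add _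
      have := ((hid.fun_pow 2).add_const (θ j)).fun_div (hid.fun_pow 3) (pow_ne_zero 3 h1)
      refine this.congr_deriv ?_
      rw [sub_eq_add_neg (θ j) (θ i)]
      generalize θ j + -θ i = x at *
      field_simp
      push_cast
      ring
    have hid : HasDerivAt (fun s : ℝ => θ i + s) 1 (-θ i) := (hasDerivAt_id' _).const_add _
    have := ((hid.fun_pow 2).add_const (θ i)).fun_mul (HasDerivAt.fun_finsetProd hf)
    refine this.congr_deriv ?_
    have e : ∀ j ∈ Finset.univ.erase i,
        (∏ k ∈ (Finset.univ.erase i).erase j, ((θ k + -θ i) ^ 2 + θ k) / (θ k + -θ i) ^ 3) •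
        (((θ j + -θ i) ^ 2 + θ j) / (θ j + -θ i) ^ 3 *
            (2 * (θ j - θ i) / ((θ j - θ i) ^ 2 + θ j) - 3 / (θ j - θ i)))
        = (∏ k ∈ Finset.univ.erase i, ((θ k + -θ i) ^ 2 + θ k) / (θ k + -θ i) ^ 3) *
            (2 * (θ j - θ i) / ((θ j - θ i) ^ 2 + θ j) - 3 / (θ j - θ i)) := by
      intro j hj
      rw [← Finset.prod_erase_mul _ _ hj, smul_eq_mul, mul_assoc]
    rw [Finset.sum_congr rfl e, ← Finset.mul_sum]
    simp [Acoef2, Acoef1, sub_eq_add_neg, mul_assoc]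
  rw [hg, ← hder.deriv]
  exact han.deriv.continuousAt.tendsto.mono_left nhdsWithin_le_nhds
end

section
/- Let n ≥ 1 and let θ_1, …, θ_n > 0 be pairwise distinct. For each i, let g(s) = (s + θ_i)³ · ∏_{j=1}^{n} ((θ_j + s)² + θ_j)/(θ_j + s)³, defined for s in a punctured neighborhood of −θ_i and extended by its limit at −θ_i. Then lim_{s → −θ_i} (1/2) g″(s) = (A_{i1}/2)( ∑_{j≠i} ( 2(θ_j−θ_i)/((θ_j−θ_i)²+θ_j) − 3/(θ_j−θ_i) ) )² + (A_{i1}/2)( 2/θ_i + ∑_{j≠i} ( −2((θ_j−θ_i)²−θ_j)/((θ_j−θ_i)²+θ_j)² + 3/(θ_j−θ_i)² ) ), i.e. the limit of half the second derivative equals A_{i3}. -/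
open MeasureTheory ProbabilityTheory Finset Filter Topology

lemma aux_prod {ι : Type*} (S : Finset ι) (f : ι → ℝ → ℝ) (l : ι → ℝ) (x : ℝ)
    (h : ∀ j ∈ S, HasDerivAt (f j) (f j x * l j) x) :
    HasDerivAt (fun y => ∏ j ∈ S, f j y) ((∏ j ∈ S, f j x) * ∑ j ∈ S, l j) x := by
  classical
  induction S using Finset.induction_on with
  | empty => simpa using hasDerivAt_const x (1 : ℝ)
  | insert a S ha ih =>
    have h1 := h a (Finset.mem_insert_self a S)
    have h2 := ih (fun j hj => h j (Finset.mem_insert_of_mem hj))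
    have h3 := h1.mul h2
    have e : (fun y => ∏ j ∈ insert a S, f j y) = f a * (fun y => ∏ j ∈ S, f j y) := by
      funext y
      simp [Finset.prod_insert ha]
    rw [e]
    refine h3.congr_deriv ?_
    rw [Finset.prod_insert ha, Finset.sum_insert ha]
    ring

lemma aux_f (t x : ℝ) (ht : 0 < t) (hx : t + x ≠ 0) :
    HasDerivAt (fun s => ((t + s) ^ 2 + t) / (t + s) ^ 3)
      (((t + x) ^ 2 + t) / (t + x) ^ 3 *
        (2 * (t + x) / ((t + x) ^ 2 + t) - 3 / (t + x))) x := by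
  have h0 : HasDerivAt (fun s => t + s) 1 x := (hasDerivAt_id x).const_add t
  have hq : (t + x) ^ 2 + t ≠ 0 := by positivity
  refine (((h0.fun_pow 2).add_const t).fun_div (h0.fun_pow 3) (pow_ne_zero 3 hx)).congr_deriv ?_
  field_simp
  push_cast
  ring

lemma aux_l (t x : ℝ) (ht : 0 < t) (hx : t + x ≠ 0) :
    HasDerivAt (fun s => 2 * (t + s) / ((t + s) ^ 2 + t) - 3 / (t + s))
      (-2 * ((t + x) ^ 2 - t) / ((t + x) ^ 2 + t) ^ 2 + 3 / (t + x) ^ 2) x := by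
  have h0 : HasDerivAt (fun s => t + s) 1 x := (hasDerivAt_id x).const_add t
  have hq : (t + x) ^ 2 + t ≠ 0 := by positivity
  refine (((h0.const_mul 2).fun_div ((h0.fun_pow 2).add_const t) hq).fun_sub
    ((hasDerivAt_const x (3 : ℝ)).fun_div h0 hx)).congr_deriv ?_
  field_simp
  push_cast
  ring

/-- The limit of half the second derivative of `g` at `s = -θ_i` equals `A_{i3}`. -/
theorem limit_deriv2_Acoef3 {n : ℕ} (hn : 1 ≤ n)
    (θ : Fin n → ℝ) (hθpos : ∀ i, 0 < θ i) (hθdist : Function.Injective θ) (i : Fin n) :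
    Tendsto (fun s => (1 / 2 : ℝ) * deriv (deriv (gfun θ i)) s)
      (𝓝[≠] (-θ i)) (𝓝 (Acoef3 θ i)) := by
  classical
  set S := Finset.univ.erase i with hS
  let P : ℝ → ℝ := fun s => ∏ j ∈ S, ((θ j + s) ^ 2 + θ j) / (θ j + s) ^ 3
  let L : ℝ → ℝ := fun s => ∑ j ∈ S, (2 * (θ j + s) / ((θ j + s) ^ 2 + θ j) - 3 / (θ j + s))
  let M : ℝ → ℝ := fun s => ∑ j ∈ S,
    (-2 * ((θ j + s) ^ 2 - θ j) / ((θ j + s) ^ 2 + θ j) ^ 2 + 3 / (θ j + s) ^ 2)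
  let q : ℝ → ℝ := fun s => (θ i + s) ^ 2 + θ i
  have hg : gfun θ i = fun s => q s * P s := by
    funext s
    unfold gfun
    split_ifs with h
    · subst h
      simp only [Acoef1, q, P, ← sub_eq_add_neg, sub_self]
      norm_num
      exact Or.inl rfl
    · have hs : θ i + s ≠ 0 := fun h' => h (by linarith)
      rw [← Finset.mul_prod_erase Finset.univ _ (Finset.mem_univ i), ← mul_assoc]
      simp only [q, P, hS]
      congr 1
      rw [add_comm s]
      field_simp
  have hU : ∀ᶠ s in 𝓝 (-θ i), ∀ j ∈ S, θ j + s ≠ 0 := by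
    rw [Filter.eventually_all_finset]
    intro j hj
    have hc : ContinuousAt (fun s => θ j + s) (-θ i) := by fun_prop
    refine hc.eventually_ne ?_
    intro h
    exact (Finset.mem_erase.1 hj).1 (hθdist (by linarith))
  have hP : ∀ s, (∀ j ∈ S, θ j + s ≠ 0) → HasDerivAt P (P s * L s) s := fun s hs =>
    aux_prod S (fun j s => ((θ j + s) ^ 2 + θ j) / (θ j + s) ^ 3) _ s
      (fun j hj => aux_f (θ j) s (hθpos j) (hs j hj))
  have hL : ∀ s, (∀ j ∈ S, θ j + s ≠ 0) → HasDerivAt L (M s) s := fun s hs =>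
    HasDerivAt.fun_sum (fun j hj => aux_l (θ j) s (hθpos j) (hs j hj))
  have h0 : ∀ s, HasDerivAt (fun s => θ i + s) 1 s := fun s => (hasDerivAt_id s).const_add _
  have hq : ∀ s, HasDerivAt q (2 * (θ i + s)) s := fun s =>
    (((h0 s).fun_pow 2).add_const (θ i)).congr_deriv (by simp)
  have h1 : ∀ s, (∀ j ∈ S, θ j + s ≠ 0) →
      deriv (gfun θ i) s = 2 * (θ i + s) * P s + q s * (P s * L s) := fun s hs => by
    rw [hg]
    exact ((hq s).fun_mul (hP s hs)).deriv
  have h2 : ∀ᶠ s in 𝓝 (-θ i), deriv (deriv (gfun θ i)) s =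
      (2 * P s + 2 * (θ i + s) * (P s * L s)) + (2 * (θ i + s) * (P s * L s)
        + q s * (P s * L s * L s + P s * M s)) := by
    filter_upwards [hU.eventually_nhds] with s hs
    have e : deriv (gfun θ i) =ᶠ[𝓝 s]
        fun s => 2 * (θ i + s) * P s + q s * (P s * L s) := hs.mono h1
    have hs' := hs.self_of_nhds
    rw [e.deriv_eq]
    have := (((h0 s).const_mul 2).fun_mul (hP s hs')).fun_add
      ((hq s).fun_mul ((hP s hs').fun_mul (hL s hs')))
    rw [this.deriv]
    ring
  have hs := hU.self_of_nhds
  have cP := (hP _ hs).continuousAt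
  have cL := (hL _ hs).continuousAt
  have cq := (hq (-θ i)).continuousAt
  have cM : ContinuousAt M (-θ i) := by
    refine tendsto_finsetSum _ fun j hj => ?_
    have a1 := hs j hj
    have a2 : ((θ j + -θ i) ^ 2 + θ j) ^ 2 ≠ 0 := by
      have := hθpos j
      positivity
    have a3 : (θ j + -θ i) ^ 2 ≠ 0 := pow_ne_zero 2 a1
    have : ContinuousAt (fun s => -2 * ((θ j + s) ^ 2 - θ j) / ((θ j + s) ^ 2 + θ j) ^ 2
      + 3 / (θ j + s) ^ 2) (-θ i) :=
      ContinuousAt.add (ContinuousAt.div (by fun_prop) (by fun_prop) a2)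
        (ContinuousAt.div (by fun_prop) (by fun_prop) a3)
    exact this
  have cT : ContinuousAt (fun s => (1 / 2 : ℝ) * ((2 * P s + 2 * (θ i + s) * (P s * L s)) +
      (2 * (θ i + s) * (P s * L s) + q s * (P s * L s * L s + P s * M s)))) (-θ i) := by
    fun_prop
  have hval : (1 / 2 : ℝ) * ((2 * P (-θ i) + 2 * (θ i + -θ i) * (P (-θ i) * L (-θ i))) +
      (2 * (θ i + -θ i) * (P (-θ i) * L (-θ i)) + q (-θ i) * (P (-θ i) * L (-θ i) * L (-θ i)
        + P (-θ i) * M (-θ i)))) = Acoef3 θ i := by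
    have e1 : Acoef1 θ i = θ i * P (-θ i) := by
      simp only [Acoef1, P, sub_eq_add_neg, hS]
    have e3 : Acoef3 θ i = Acoef1 θ i / 2 * L (-θ i) ^ 2
        + Acoef1 θ i / 2 * (2 / θ i + M (-θ i)) := by
      simp only [Acoef3, L, M, ← sub_eq_add_neg, hS]
    have e4 : q (-θ i) = θ i := by simp [q]
    have := (hθpos i).ne'
    rw [e3, e1, e4]
    field_simp
    ring
  have hT := cT.tendsto
  simp only [hval] at hT
  refine (hT.mono_left nhdsWithin_le_nhds).congr' ?_
  filter_upwards [h2.filter_mono nhdsWithin_le_nhds] with s hs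
  rw [hs]
end

section
/- Let θ > 0 and let X be a random variable with the XGamma distribution XG(θ). Then for every t < θ, the moment generating function of X satisfies Φ_X(t) = E[e^{tX}] = θ² ((θ − t)² + θ) / ( (1 + θ)(θ − t)³ ). -/
open MeasureTheory ProbabilityTheory Finset Filter Topology

/-- The MGF of an XGamma random variable: `Φ_X(t) = θ²((θ-t)²+θ)/((1+θ)(θ-t)³)` for
`t < θ`. -/
theorem xgamma_mgf {Ω : Type*} [MeasurableSpace Ω]
    (μ : Measure Ω) [IsProbabilityMeasure μ]
    (θ : ℝ) (hθ : 0 < θ) (X : Ω → ℝ) (hXmeas : Measurable X)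
    (hlaw : Measure.map X μ
      = (volume : Measure ℝ).withDensity fun t => ENNReal.ofReal (xgPDF θ t))
    (t : ℝ) (ht : t < θ) :
    mgf X μ t = θ ^ 2 * ((θ - t) ^ 2 + θ) / ((1 + θ) * (θ - t) ^ 3) := by
  have hs : 0 < θ - t := sub_pos.2 ht
  have hmeas : Measurable (xgPDF θ) := by
    unfold xgPDF
    exact Measurable.ite measurableSet_Ici (by fun_prop) measurable_const
  have hnn : ∀ x, 0 ≤ xgPDF θ x := by
    intro x
    unfold xgPDF
    split_ifs <;> positivity
  have h0 : ∫ x in Set.Ioi (0:ℝ), Real.exp (-((θ - t) * x)) = 1 / (θ - t) := by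
    have h := Real.integral_rpow_mul_exp_neg_mul_Ioi (a := 1) one_pos hs
    simpa using h
  have h2 : ∫ x in Set.Ioi (0:ℝ), x ^ 2 * Real.exp (-((θ - t) * x)) = 2 / (θ - t) ^ 3 := by
    have h := Real.integral_rpow_mul_exp_neg_mul_Ioi (a := 3) (by norm_num) hs
    have e : (3:ℝ) - 1 = (2:ℕ) := by norm_num
    have e3 : (3:ℝ) = (3:ℕ) := by norm_num
    have g : Real.Gamma 3 = 2 := by
      have := Real.Gamma_nat_eq_factorial 2
      rw [show (3:ℝ) = ((2:ℕ):ℝ) + 1 by norm_num, this]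
      norm_num [Nat.factorial]
    rw [g, e] at h
    simp only [Real.rpow_natCast] at h
    rw [h, e3, Real.rpow_natCast]
    field_simp
  have i0 : IntegrableOn (fun x => Real.exp (-((θ - t) * x))) (Set.Ioi (0:ℝ)) := by
    by_contra hc
    rw [integral_undef hc] at h0
    exact absurd h0 (by positivity)
  have i2 : IntegrableOn (fun x => x ^ 2 * Real.exp (-((θ - t) * x))) (Set.Ioi (0:ℝ)) := by
    by_contra hc
    rw [integral_undef hc] at h2
    exact absurd h2 (by positivity)
  have hm : mgf X μ t = ∫ x, Real.exp (t * x) ∂(Measure.map X μ) := by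
    rw [integral_map hXmeas.aemeasurable (by fun_prop)]
    rfl
  rw [hm, hlaw, integral_withDensity_eq_integral_toReal_smul (by fun_prop) (by simp)]
  have hind : (fun x => (ENNReal.ofReal (xgPDF θ x)).toReal • Real.exp (t * x))
      = Set.indicator (Set.Ici 0) (fun x => θ ^ 2 / (1 + θ) * Real.exp (-((θ - t) * x))
        + θ ^ 2 / (1 + θ) * (θ / 2) * (x ^ 2 * Real.exp (-((θ - t) * x)))) := by
    funext x
    rw [ENNReal.toReal_ofReal (hnn x)]
    by_cases hx : 0 ≤ x
    · have he : Real.exp (-((θ - t) * x)) = Real.exp (-θ * x) * Real.exp (t * x) := by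
        rw [← Real.exp_add]
        ring_nf
      simp only [xgPDF, hx, if_true, Set.indicator, Set.mem_Ici, he, smul_eq_mul]
      ring
    · simp [xgPDF, hx, Set.indicator]
  rw [hind, integral_indicator measurableSet_Ici, integral_Ici_eq_integral_Ioi,
    integral_add (i0.const_mul _) (i2.const_mul _), integral_const_mul, integral_const_mul, h0, h2]
  field_simp
end
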